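/- Let (A, μ_{α,β}, p_ω, q_ω) be a BiHom-Ω-associative algebra, (N_ω) a family of linear maps on A commuting with p_ω, q_ω, and define μ^N_{α,β}(a,b) = μ_{α,β}(N_α(a), b) + μ_{α,β}(a, N_β(b)) − N_{αβ}μ_{α,β}(a,b) and ψ^N_{α,β}(a,b) = μ_{α,β}(N_α(a), N_β(b)) − N_{αβ}μ^N_{α,β}(a,b). Suppose additionally that identity (ii) of the linear deformation holds: μ_{αβ,γ}(μ^N_{α,β}(a,b), q_γ(c)) + μ^N_{αβ,γ}(μ_{α,β}(a,b), q_γ(c)) = μ_{α,βγ}(p_α(a), μ^N_{β,γ}(b,c)) + μ^N_{α,βγ}(p_α(a), μ_{β,γ}(b,c)). Then (δ²_Alg ψ^N)_{α,β,γ}(a,b,c) = μ^N_{αβ,γ}(μ^N_{α,β}(a,b), q_γ(c)) − μ^N_{α,βγ}(p_α(a), μ^N_{β,γ}(b,c)); consequently, (A, μ^N_{α,β}, p_ω, q_ω) is a BiHom-Ω-associative algebra if and only if (ψ^N_{α,β}) is a 2-cocycle in C²_Ω(A). -/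

import Mathlib

/-- A BiHom-`Ω`-associative algebra structure. -/
def IsBiHomAssoc {k Ω A : Type*} [CommRing k] [Semigroup Ω]
    [AddCommGroup A] [Module k A]
    (mul : Ω → Ω → A →ₗ[k] A →ₗ[k] A) (p q : Ω → A →ₗ[k] A) : Prop :=
  (∀ α β x, p α (q β x) = q β (p α x)) ∧
  (∀ α β x y, p (α * β) (mul α β x y) = mul α β (p α x) (p β y)) ∧
  (∀ α β x y, q (α * β) (mul α β x y) = mul α β (q α x) (q β y)) ∧
  (∀ α β γ x y z,
    mul α (β * γ) (p α x) (mul β γ y z) = mul (α * β) γ (mul α β x y) (q γ z))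

/-- The product deformed by a family `N`. -/
def nijMul {k Ω A : Type*} [CommRing k] [Semigroup Ω]
    [AddCommGroup A] [Module k A]
    (mul : Ω → Ω → A →ₗ[k] A →ₗ[k] A) (N : Ω → A →ₗ[k] A)
    (α β : Ω) : A →ₗ[k] A →ₗ[k] A :=
  (mul α β).comp (N α) + (mul α β).compl₂ (N β) - (mul α β).compr₂ (N (α * β))

/-- `ψ^N_{α,β}(a,b) = μ_{α,β}(N_α a, N_β b) − N_{αβ} μ^N_{α,β}(a,b)`. -/
def psiN {k Ω A : Type*} [CommRing k] [Semigroup Ω]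
    [AddCommGroup A] [Module k A]
    (mul : Ω → Ω → A →ₗ[k] A →ₗ[k] A) (N : Ω → A →ₗ[k] A)
    (α β : Ω) : A →ₗ[k] A →ₗ[k] A :=
  ((mul α β).comp (N α)).compl₂ (N β) - (nijMul mul N α β).compr₂ (N (α * β))

/-- The coboundary `δ²_Alg` (regular coefficients) applied to a 2-cochain `f`. -/
def dAlg2 {k Ω A : Type*} [CommRing k] [Semigroup Ω]
    [AddCommGroup A] [Module k A]
    (mul : Ω → Ω → A →ₗ[k] A →ₗ[k] A) (p q : Ω → A →ₗ[k] A)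
    (f : Ω → Ω → A →ₗ[k] A →ₗ[k] A)
    (α β γ : Ω) (a b c : A) : A :=
  mul α (β * γ) (p α a) (f β γ b c) - f (α * β) γ (mul α β a b) (q γ c)
    + f α (β * γ) (p α a) (mul β γ b c) - mul (α * β) γ (f α β a b) (q γ c)

section

variable {k Ω A : Type*} [CommRing k] [Semigroup Ω] [AddCommGroup A] [Module k A]

theorem nijMul_apply (mul : Ω → Ω → A →ₗ[k] A →ₗ[k] A) (N : Ω → A →ₗ[k] A) (α β : Ω) (x y : A) :
    nijMul mul N α β x y
      = mul α β (N α x) y + mul α β x (N β y) - N (α * β) (mul α β x y) := rfl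

theorem psiN_apply (mul : Ω → Ω → A →ₗ[k] A →ₗ[k] A) (N : Ω → A →ₗ[k] A) (α β : Ω) (x y : A) :
    psiN mul N α β x y
      = mul α β (N α x) (N β y) - N (α * β) (nijMul mul N α β x y) := rfl

/-- A multiplicative family commuting with `N` is multiplicative for the deformed product. -/
theorem map_nijMul {mul : Ω → Ω → A →ₗ[k] A →ₗ[k] A} {N p : Ω → A →ₗ[k] A}
    (hp : ∀ α β x y, p (α * β) (mul α β x y) = mul α β (p α x) (p β y))
    (hN : ∀ ω x, N ω (p ω x) = p ω (N ω x)) (α β : Ω) (x y : A) :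
    p (α * β) (nijMul mul N α β x y) = nijMul mul N α β (p α x) (p β y) := by
  simp only [nijMul_apply, map_add, map_sub, hN, ← hp]

/-- The coboundary of `ψ^N` is the associator of the deformed product. -/
theorem dAlg2_psiN_apply {mul : Ω → Ω → A →ₗ[k] A →ₗ[k] A} {N p q : Ω → A →ₗ[k] A}
    (hassoc : ∀ α β γ x y z,
      mul α (β * γ) (p α x) (mul β γ y z) = mul (α * β) γ (mul α β x y) (q γ z))
    (hNp : ∀ ω x, N ω (p ω x) = p ω (N ω x))
    (hNq : ∀ ω x, N ω (q ω x) = q ω (N ω x))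
    (hii : ∀ α β γ a b c,
      mul (α * β) γ (nijMul mul N α β a b) (q γ c)
          + nijMul mul N (α * β) γ (mul α β a b) (q γ c)
        = mul α (β * γ) (p α a) (nijMul mul N β γ b c)
          + nijMul mul N α (β * γ) (p α a) (mul β γ b c))
    (α β γ : Ω) (a b c : A) :
    dAlg2 mul p q (psiN mul N) α β γ a b c
      = nijMul mul N (α * β) γ (nijMul mul N α β a b) (q γ c)
        - nijMul mul N α (β * γ) (p α a) (nijMul mul N β γ b c) := by
  have hN := congrArg (N (α * β * γ)) (hii α β γ a b c)
  have left : mul (α * β) γ (nijMul mul N α β a b) (q γ (N γ c))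
      = mul α (β * γ) (p α (N α a)) (mul β γ b (N γ c))
        + mul α (β * γ) (p α a) (mul β γ (N β b) (N γ c))
        - mul (α * β) γ (N (α * β) (mul α β a b)) (q γ (N γ c)) := by
    simp only [nijMul_apply, map_add, map_sub, LinearMap.add_apply, LinearMap.sub_apply, hassoc]
  have right : mul α (β * γ) (p α (N α a)) (nijMul mul N β γ b c)
      = mul (α * β) γ (mul α β (N α a) (N β b)) (q γ c)
        + mul α (β * γ) (p α (N α a)) (mul β γ b (N γ c))
        - mul α (β * γ) (p α (N α a)) (N (β * γ) (mul β γ b c)) := by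
    simp only [nijMul_apply, map_add, map_sub, hassoc]
  simp only [dAlg2, psiN_apply, nijMul_apply mul N (α * β) γ (nijMul mul N α β a b),
    nijMul_apply mul N α (β * γ) (p α a) (nijMul mul N β γ b c), map_sub, map_add,
    LinearMap.sub_apply, hNp, hNq, left, right, ← mul_assoc] at hN ⊢
  linear_combination (norm := module) hN

end

/-- If the linear-deformation identity (ii) holds for `μ^N`, then
`(δ²_Alg ψ^N)(a,b,c) = μ^N(μ^N(a,b), q c) − μ^N(p a, μ^N(b,c))`; consequently
`(A, μ^N, p, q)` is a BiHom-`Ω`-associative algebra if and only if `ψ^N` is a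
2-cocycle. -/
theorem dAlg2_psiN
    {k Ω A : Type*} [CommRing k] [Semigroup Ω] [AddCommGroup A] [Module k A]
    (mul : Ω → Ω → A →ₗ[k] A →ₗ[k] A) (N p q : Ω → A →ₗ[k] A)
    (hA : IsBiHomAssoc mul p q)
    (hNp : ∀ ω x, N ω (p ω x) = p ω (N ω x))
    (hNq : ∀ ω x, N ω (q ω x) = q ω (N ω x))
    (hii : ∀ α β γ a b c,
      mul (α * β) γ (nijMul mul N α β a b) (q γ c)
          + nijMul mul N (α * β) γ (mul α β a b) (q γ c)
        = mul α (β * γ) (p α a) (nijMul mul N β γ b c)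
          + nijMul mul N α (β * γ) (p α a) (mul β γ b c)) :
    (∀ α β γ a b c,
      dAlg2 mul p q (psiN mul N) α β γ a b c
        = nijMul mul N (α * β) γ (nijMul mul N α β a b) (q γ c)
          - nijMul mul N α (β * γ) (p α a) (nijMul mul N β γ b c)) ∧
    (IsBiHomAssoc (nijMul mul N) p q ↔
      ∀ α β γ a b c, dAlg2 mul p q (psiN mul N) α β γ a b c = 0) := by
  obtain ⟨hpq, hp, hq, hassoc⟩ := hA
  have key := dAlg2_psiN_apply hassoc hNp hNq hii
  refine ⟨key, ?_⟩
  simp only [key, sub_eq_zero]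
  exact ⟨fun h α β γ a b c => (h.2.2.2 α β γ a b c).symm, fun h =>
    ⟨hpq, map_nijMul hp hNp, map_nijMul hq hNq, fun α β γ a b c => (h α β γ a b c).symm⟩⟩
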